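/- arXiv:1801.06694 — 4 statements merged into one kernel-verified Lean document; each statement's English description precedes it below -/
import Mathlib

section
/- Let m, a, b, k be real numbers with 0 ≤ a ≤ 1/2, 0 ≤ b ≤ 1/2 and −b ≤ k ≤ a, let η be a positive integer, and let μ : ℕ → ℝ satisfy m − (b + k)/i ≤ μ(i) ≤ m + (a − k)/i for every integer i with 1 ≤ i ≤ η. Define l(i) = max{ μ(j) − 1/j : 1 ≤ j ≤ i } and u(i) = min{ μ(j) + 1/j : 1 ≤ j ≤ i }. Then for every integer i with 1 ≤ i ≤ η we have μ(i) − 1/i ≤ l(i) ≤ m − (1 − a + k)/i and m + (1 − b − k)/i ≤ u(i) ≤ μ(i) + 1/i. -/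
/-- Bounds for the running lower and upper slope-boundary estimates
`l(i) = max { μ(j) − 1/j : 1 ≤ j ≤ i }` and
`u(i) = min { μ(j) + 1/j : 1 ≤ j ≤ i }` of a digital straight segment whose
slope function `μ` satisfies `m − (b+k)/i ≤ μ(i) ≤ m + (a−k)/i` for
`1 ≤ i ≤ η`. -/
theorem running_slope_boundary_estimates (m a b k : ℝ)
    (ha0 : 0 ≤ a) (ha : a ≤ 1/2) (hb0 : 0 ≤ b) (hb : b ≤ 1/2)
    (hk1 : -b ≤ k) (hk2 : k ≤ a)
    (η : ℕ) (hη : 0 < η) (μ : ℕ → ℝ)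
    (hμ : ∀ i : ℕ, 1 ≤ i → i ≤ η →
      m - (b + k) / (i : ℝ) ≤ μ i ∧ μ i ≤ m + (a - k) / (i : ℝ)) :
    ∀ i : ℕ, ∀ hi : 1 ≤ i, i ≤ η →
      (μ i - 1 / (i : ℝ)
          ≤ (Finset.Icc 1 i).sup' (Finset.nonempty_Icc.mpr hi)
              (fun j => μ j - 1 / (j : ℝ)) ∧
        (Finset.Icc 1 i).sup' (Finset.nonempty_Icc.mpr hi)
              (fun j => μ j - 1 / (j : ℝ))
          ≤ m - (1 - a + k) / (i : ℝ)) ∧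
      (m + (1 - b - k) / (i : ℝ)
          ≤ (Finset.Icc 1 i).inf' (Finset.nonempty_Icc.mpr hi)
              (fun j => μ j + 1 / (j : ℝ)) ∧
        (Finset.Icc 1 i).inf' (Finset.nonempty_Icc.mpr hi)
              (fun j => μ j + 1 / (j : ℝ))
          ≤ μ i + 1 / (i : ℝ)) := by
  intro i hi hiη
  have hmem : i ∈ Finset.Icc 1 i := Finset.right_mem_Icc.mpr hi
  have hle_div : ∀ c : ℝ, 0 ≤ c → ∀ j ∈ Finset.Icc 1 i, c / (i : ℝ) ≤ c / (j : ℝ) := by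
    intro c hc j hj
    obtain ⟨hj1, hji⟩ := Finset.mem_Icc.mp hj
    have hj0 : (0 : ℝ) < j := by exact_mod_cast hj1
    have hji' : (j : ℝ) ≤ i := by exact_mod_cast hji
    exact div_le_div_of_nonneg_left hc hj0 hji'
  have hμ' : ∀ j ∈ Finset.Icc 1 i,
      m - (b + k) / (j : ℝ) ≤ μ j ∧ μ j ≤ m + (a - k) / (j : ℝ) := fun j hj =>
    hμ j (Finset.mem_Icc.mp hj).1 ((Finset.mem_Icc.mp hj).2.trans hiη)
  refine ⟨⟨Finset.le_sup' (fun j => μ j - 1 / (j : ℝ)) hmem, Finset.sup'_le _ _ fun j hj => ?_⟩,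
    Finset.le_inf' _ _ fun j hj => ?_, Finset.inf'_le (fun j => μ j + 1 / (j : ℝ)) hmem⟩
  · have hdiv := hle_div (1 - a + k) (by linarith) j hj
    have hsplit : (1 - a + k) / (j : ℝ) = 1 / j - (a - k) / j := by ring
    linarith [(hμ' j hj).2]
  · have hdiv := hle_div (1 - b - k) (by linarith) j hj
    have hsplit : (1 - b - k) / (j : ℝ) = 1 / j - (b + k) / j := by ring
    linarith [(hμ' j hj).1]
end

section
/- Let m, a, b, k be real numbers with 0 ≤ a ≤ 1/2, 0 ≤ b ≤ 1/2 and −b ≤ k ≤ a, let η be a positive integer, and let μ : ℕ → ℝ satisfy m − (b + k)/i ≤ μ(i) ≤ m + (a − k)/i for every integer i with 1 ≤ i ≤ η. Define l(i) = max{ μ(j) − 1/j : 1 ≤ j ≤ i } and u(i) = min{ μ(j) + 1/j : 1 ≤ j ≤ i }. Then for every integer i with 1 ≤ i ≤ η, u(i) − l(i) ≥ (2 − (a + b))/i ≥ 1/i. -/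
/-- For the running slope-boundary estimates `l` and `u` of a digital straight
segment whose slope function `μ` satisfies the slope boundaries up to distance
`η`, the difference `u(i) − l(i)` is at least `(2 − (a+b))/i ≥ 1/i`. -/
theorem running_slope_boundary_gap (m a b k : ℝ)
    (ha0 : 0 ≤ a) (ha : a ≤ 1/2) (hb0 : 0 ≤ b) (hb : b ≤ 1/2)
    (hk1 : -b ≤ k) (hk2 : k ≤ a)
    (η : ℕ) (hη : 0 < η) (μ : ℕ → ℝ)
    (hμ : ∀ i : ℕ, 1 ≤ i → i ≤ η →
      m - (b + k) / (i : ℝ) ≤ μ i ∧ μ i ≤ m + (a - k) / (i : ℝ)) :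
    ∀ i : ℕ, ∀ hi : 1 ≤ i, i ≤ η →
      (Finset.Icc 1 i).inf' (Finset.nonempty_Icc.mpr hi)
            (fun j => μ j + 1 / (j : ℝ))
        - (Finset.Icc 1 i).sup' (Finset.nonempty_Icc.mpr hi)
            (fun j => μ j - 1 / (j : ℝ))
        ≥ (2 - (a + b)) / (i : ℝ) ∧
      (2 - (a + b)) / (i : ℝ) ≥ 1 / (i : ℝ) := by
  intro i hi hiη
  have hi0 : (0 : ℝ) < i := by exact_mod_cast hi
  have div_anti (c : ℝ) (hc : 0 ≤ c) (j : ℕ) (hj : j ∈ Finset.Icc 1 i) :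
      c / (i : ℝ) ≤ c / (j : ℝ) := by
    rw [Finset.mem_Icc] at hj
    have hj0 : (0 : ℝ) < j := by exact_mod_cast hj.1
    have hji : (j : ℝ) ≤ i := by exact_mod_cast hj.2
    exact div_le_div_of_nonneg_left hc hj0 hji
  have hu : m + (1 - (b + k)) / (i : ℝ) ≤
      (Finset.Icc 1 i).inf' (Finset.nonempty_Icc.mpr hi) (fun j => μ j + 1 / (j : ℝ)) := by
    refine Finset.le_inf' _ _ fun j hj => ?_
    have hle := div_anti (1 - (b + k)) (by linarith) j hj
    rw [sub_div 1 _ (j : ℝ)] at hle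
    rw [Finset.mem_Icc] at hj
    linarith [(hμ j hj.1 (hj.2.trans hiη)).1]
  have hl : (Finset.Icc 1 i).sup' (Finset.nonempty_Icc.mpr hi) (fun j => μ j - 1 / (j : ℝ)) ≤
      m - (1 - (a - k)) / (i : ℝ) := by
    refine Finset.sup'_le _ _ fun j hj => ?_
    have hle := div_anti (1 - (a - k)) (by linarith) j hj
    rw [sub_div 1 _ (j : ℝ)] at hle
    rw [Finset.mem_Icc] at hj
    linarith [(hμ j hj.1 (hj.2.trans hiη)).2]
  have hsum : (2 - (a + b)) / (i : ℝ) = (1 - (b + k)) / i + (1 - (a - k)) / i := by ring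
  exact ⟨by linarith, div_le_div_of_nonneg_right (by linarith) hi0.le⟩
end

section
/- Let m be an irrational real number and c a real number, and consider the optimal digital straight line with slope m and intercept c. Then the line is aperiodic: for every positive integer s there is no integer r such that ⌊m·(x + s) + c + 1/2⌋ = ⌊m·x + c + 1/2⌋ + r holds for all integers x. -/
/-- If the digital line of slope `m` has period `s` with vertical shift `r`, then `m * s = r`. -/
theorem mul_eq_of_floor_add_periodic {m b : ℝ} {s : ℕ} {r : ℤ}
    (h : ∀ x : ℤ, ⌊m * ((x : ℝ) + (s : ℝ)) + b⌋ = ⌊m * (x : ℝ) + b⌋ + r) :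
    m * s = r := by
  have floor_eq (k : ℕ) : ⌊k * (m * s) + b⌋ = ⌊b⌋ + k * r := by
    induction k with
    | zero => simp
    | succ k ih =>
      have hk := h (k * s)
      push_cast at hk ⊢
      rw [show m * (k * s + s) + b = (k + 1) * (m * s) + b by ring,
        show m * (k * s) + b = k * (m * s) + b by ring, ih] at hk
      rw [hk]
      ring
  by_contra hne
  have hpos : 0 < |m * s - r| := abs_pos.mpr (sub_ne_zero.mpr hne)
  obtain ⟨k, hk⟩ := exists_nat_gt (1 / |m * s - r|)
  rw [div_lt_iff₀ hpos, ← Nat.abs_cast k, ← abs_mul] at hk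
  obtain ⟨h₁, h₂⟩ := Int.floor_eq_iff.mp (floor_eq k)
  push_cast at h₁ h₂
  have hb₁ := Int.floor_le b
  have hb₂ := Int.lt_floor_add_one b
  refine hk.not_gt (abs_lt.mpr ⟨?_, ?_⟩) <;> linarith

/-- The optimal digital straight line with irrational slope `m` is aperiodic:
for every positive integer `s` there is no integer `r` such that translating
every point by `(s, r)` yields the same line. -/
theorem irrational_optimal_line_aperiodic (m : ℝ) (hm : Irrational m) (c : ℝ) :
    ∀ s : ℕ, 0 < s →
      ¬ ∃ r : ℤ, ∀ x : ℤ,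
        ⌊m * ((x : ℝ) + (s : ℝ)) + c + 1/2⌋ = ⌊m * (x : ℝ) + c + 1/2⌋ + r := by
  rintro s hs ⟨r, h⟩
  simp only [add_assoc _ c] at h
  exact (hm.mul_natCast hs.ne').ne_int r (mul_eq_of_floor_add_periodic h)
end

section
/- Let m be an irrational real number and c a real number, and consider the optimal digital straight line L with slope m and intercept c. Then no two distinct points of L have identical slope functions: for any two distinct integers x₁ and x₂ there exists a positive integer i such that ⌊m·(x₁ + i) + c + 1/2⌋ − ⌊m·x₁ + c + 1/2⌋ ≠ ⌊m·(x₂ + i) + c + 1/2⌋ − ⌊m·x₂ + c + 1/2⌋, i.e. μ_{Lp}(i) ≠ μ_{Lq}(i) for the points p and q of L at abscissas x₁ and x₂. -/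
/-- If `⌊m * x + b⌋` increases by exactly `K` at each step of a progression of step `d`, then
`m * d = K`. -/
theorem mul_eq_of_floor_arithmetic_progression {m b x : ℝ} {d : ℕ} {K : ℤ}
    (h : ∀ n : ℕ, ⌊m * (x + (n * d : ℕ)) + b⌋ = ⌊m * x + b⌋ + n * K) :
    m * d = K := by
  have bound (n : ℕ) : n • |m * d - K| ≤ 1 := by
    have h₁ := Int.floor_le (m * (x + (n * d : ℕ)) + b)
    have h₂ := Int.lt_floor_add_one (m * (x + (n * d : ℕ)) + b)
    rw [h n] at h₁ h₂
    push_cast at h₁ h₂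
    have h₃ := Int.floor_le (m * x + b)
    have h₄ := Int.lt_floor_add_one (m * x + b)
    rw [nsmul_eq_mul, ← Nat.abs_cast n, ← abs_mul, abs_le]
    constructor <;> linarith
  by_contra hne
  obtain ⟨n, hn⟩ := exists_lt_nsmul (abs_pos.mpr (sub_ne_zero.mpr hne)) 1
  exact absurd (bound n) hn.not_ge

/-- For irrational `m`, the increments of `⌊m * x + b⌋` from `x` and from a later point `x + d`
differ at some positive distance. -/
theorem Irrational.exists_floor_increment_ne {m : ℝ} (hm : Irrational m) (b x : ℝ) {d : ℕ}
    (hd : 0 < d) :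
    ∃ i : ℕ, 0 < i ∧
      ⌊m * (x + i) + b⌋ - ⌊m * x + b⌋ ≠ ⌊m * (x + d + i) + b⌋ - ⌊m * (x + d) + b⌋ := by
  by_contra! hinc
  have progression (n : ℕ) : ⌊m * (x + (n * d : ℕ)) + b⌋ =
      ⌊m * x + b⌋ + n * (⌊m * (x + d) + b⌋ - ⌊m * x + b⌋) := by
    induction n with
    | zero => simp
    | succ n ih =>
      rcases n.eq_zero_or_pos with rfl | hn
      · simp
      · have step := hinc (n * d) (Nat.mul_pos hn hd)
        have shift : x + ((n + 1) * d : ℕ) = x + d + (n * d : ℕ) := by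
          push_cast
          ring
        rw [shift]
        push_cast at ih step ⊢
        linarith
  exact (hm.mul_natCast hd.ne').ne_int _ (mul_eq_of_floor_arithmetic_progression progression)

/-- No two distinct points of an optimal digital straight line with irrational
slope have identical slope functions: for distinct abscissas `x₁ ≠ x₂` there is
a positive distance `i` at which the vertical increments differ. -/
theorem irrational_optimal_line_distinct_slope_functions
    (m : ℝ) (hm : Irrational m) (c : ℝ) (x₁ x₂ : ℤ) (hx : x₁ ≠ x₂) :
    ∃ i : ℕ, 0 < i ∧
      ⌊m * ((x₁ : ℝ) + (i : ℝ)) + c + 1/2⌋ - ⌊m * (x₁ : ℝ) + c + 1/2⌋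
        ≠ ⌊m * ((x₂ : ℝ) + (i : ℝ)) + c + 1/2⌋ - ⌊m * (x₂ : ℝ) + c + 1/2⌋ := by
  wlog hlt : x₁ < x₂ generalizing x₁ x₂
  · obtain ⟨i, hi, hne⟩ := this x₂ x₁ hx.symm (hx.symm.lt_of_le (not_lt.mp hlt))
    exact ⟨i, hi, hne.symm⟩
  obtain ⟨d, rfl⟩ := Int.le.dest hlt.le
  obtain ⟨i, hi, hne⟩ := hm.exists_floor_increment_ne (c + 1/2) x₁ (d := d) (by omega)
  refine ⟨i, hi, ?_⟩
  push_cast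
  simpa only [add_assoc] using hne
end
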